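/- Suppose Omega ⊆ C^n is a bounded domain, x in Omega, and f_j : Omega → C^n is a sequence of injective holomorphic maps with f_j(x) = 0 for all j, converging locally uniformly to a holomorphic map f : Omega → C^n. If there exists ε > 0 such that the ball B_ε(0) is contained in f_j(Omega) for all j, then f is injective. -/

import Mathlib

open Complex Filter

section HolomorphicMaps

open Set Metric Topology

universe u v

/-- Differentiation under the Cauchy integral: directional derivatives of a holomorphic map are
holomorphic. -/
lemma differentiableOn_fderiv_apply {E F : Type*}
    [NormedAddCommGroup E] [NormedSpace ℂ E] [FiniteDimensional ℂ E]
    [NormedAddCommGroup F] [NormedSpace ℂ F] [FiniteDimensional ℂ F]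
    {f : E → F} {U : Set E} (hf : DifferentiableOn ℂ f U) (hU : IsOpen U) (v : E) :
    DifferentiableOn ℂ (fun z => fderiv ℂ f z v) U := by
  intro z₀ hz₀
  have : CompleteSpace F := FiniteDimensional.complete ℂ F
  have : ProperSpace (E →L[ℂ] F) := FiniteDimensional.proper ℂ _
  refine DifferentiableAt.differentiableWithinAt ?_
  obtain ⟨ρ, hρ, hball, hbd⟩ :
      ∃ ρ > 0, ball z₀ ρ ⊆ U ∧ ∀ w ∈ ball z₀ ρ, dist (f w) (f z₀) < 1 := by
    have h1 : ∀ᶠ w in 𝓝 z₀, w ∈ U ∧ dist (f w) (f z₀) < 1 :=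
      Filter.Eventually.and (hU.mem_nhds hz₀)
        ((hf.differentiableAt (hU.mem_nhds hz₀)).continuousAt (ball_mem_nhds _ one_pos))
    obtain ⟨ρ, hρ, h⟩ := Metric.eventually_nhds_iff_ball.1 h1
    exact ⟨ρ, hρ, fun w hw => (h w hw).1, fun w hw => (h w hw).2⟩
  have hdiff : ∀ w ∈ ball z₀ ρ, DifferentiableAt ℂ f w := fun w hw =>
    hf.differentiableAt (hU.mem_nhds (hball hw))
  obtain ⟨c, hc, hcv⟩ : ∃ c > 0, c * ‖v‖ < ρ / 4 :=
    (exists_pos_mul_lt (show 0 < ρ / 4 by positivity) ‖v‖).imp fun c h =>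
      ⟨h.1, by rw [mul_comm]; exact h.2⟩
  have hmem : ∀ z ∈ ball z₀ (ρ / 4), ∀ t ∈ closedBall (0 : ℂ) c, z + t • v ∈ ball z₀ (ρ / 2) := by
    intro z hz t ht
    rw [mem_ball, dist_eq_norm] at hz ⊢
    have h1 : ‖t • v‖ ≤ c * ‖v‖ := by
      rw [norm_smul]; gcongr; simpa using ht
    calc ‖z + t • v - z₀‖ = ‖(z - z₀) + t • v‖ := by congr 1; abel
      _ ≤ ‖z - z₀‖ + ‖t • v‖ := norm_add_le _ _
      _ < ρ / 2 := by linarith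
  have hmem' : ∀ z ∈ ball z₀ (ρ / 4), ∀ t ∈ closedBall (0 : ℂ) c, z + t • v ∈ ball z₀ ρ :=
    fun z hz t ht => ball_subset_ball (by linarith) (hmem z hz t ht)
  have hcirc : ∀ θ, circleMap 0 c θ ∈ closedBall (0 : ℂ) c := fun θ =>
    circleMap_mem_closedBall _ hc.le _
  have hfd : ∀ w ∈ ball z₀ (ρ / 2), ‖fderiv ℂ f w‖ ≤ 2 / (ρ / 2) := by
    intro w hw
    have hsub : ball w (ρ / 2) ⊆ ball z₀ ρ :=
      ball_subset_ball' (by rw [mem_ball] at hw; linarith)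
    refine Complex.norm_fderiv_le_div_of_mapsTo_ball
      (hf.mono (hsub.trans hball)) (fun y hy => ?_) (by positivity)
    have h1 := hbd y (hsub hy)
    have h2 := hbd w (ball_subset_ball (by linarith) hw)
    rw [mem_closedBall]
    linarith [dist_triangle_right (f y) (f w) (f z₀)]
  let G : E → ℝ → F := fun z θ =>
    deriv (circleMap 0 c) θ • ((1 / (circleMap 0 c θ - 0) ^ 2 : ℂ) • f (z + circleMap 0 c θ • v))
  let G' : E → ℝ → E →L[ℂ] F := fun z θ =>
    deriv (circleMap 0 c) θ • ((1 / (circleMap 0 c θ - 0) ^ 2 : ℂ) •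
      fderiv ℂ f (z + circleMap 0 c θ • v))
  have hformula : ∀ z ∈ ball z₀ (ρ / 4),
      fderiv ℂ f z v = (2 * Real.pi * I : ℂ)⁻¹ • ∫ θ in (0 : ℝ)..2 * Real.pi, G z θ := by
    intro z hz
    have hd : ∀ t ∈ closedBall (0 : ℂ) c,
        HasDerivAt (fun t : ℂ => f (z + t • v)) (fderiv ℂ f (z + t • v) v) t := by
      intro t ht
      have h2 : HasDerivAt (fun t : ℂ => z + t • v) v t := by
        simpa using ((hasDerivAt_id t).smul_const v).const_add z
      exact (hdiff _ (hmem' z hz t ht)).hasFDerivAt.comp_hasDerivAt t h2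
    have h3 := DifferentiableOn.deriv_eq_smul_circleIntegral hc
      (f := fun t : ℂ => f (z + t • v)) (c := 0)
      (fun t ht => (hd t ht).differentiableAt.differentiableWithinAt)
    rw [(hd 0 (by simp [hc.le])).deriv] at h3
    simp only [zero_smul, add_zero] at h3
    rw [eq_inv_smul_iff₀ (by simp [Real.pi_ne_zero]), ← h3]
    rfl
  have hcontw : ∀ z ∈ ball z₀ (ρ / 4), Continuous (G z) := by
    intro z hz
    have h1 : Continuous fun θ : ℝ => f (z + circleMap 0 c θ • v) := by
      rw [continuous_iff_continuousAt]
      intro θ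
      refine ContinuousAt.comp (f := fun θ : ℝ => z + circleMap 0 c θ • v)
        (hdiff _ (hmem' z hz _ (hcirc θ))).continuousAt ?_
      fun_prop
    have h2 : Continuous fun θ : ℝ => (1 / (circleMap 0 c θ - 0) ^ 2 : ℂ) := by
      refine Continuous.div (by fun_prop) (by fun_prop) fun θ => ?_
      simp [hc.ne']
    have h3 : Continuous (deriv (circleMap 0 c)) := by
      rw [show deriv (circleMap 0 c) = fun θ => circleMap 0 c θ * I from
        funext fun θ => deriv_circleMap 0 c θ]
      fun_prop
    exact h3.smul (h2.smul h1)
  have key : HasFDerivAt (fun z => ∫ θ in (0 : ℝ)..2 * Real.pi, G z θ)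
      (∫ θ in (0 : ℝ)..2 * Real.pi, G' z₀ θ) z₀ := by
    refine intervalIntegral.hasFDerivAt_integral_of_dominated_of_fderiv_le (F := G) (F' := G')
      (bound := fun _ => c * (1 / c ^ 2 * (2 / (ρ / 2))))
      (ball_mem_nhds z₀ (show 0 < ρ / 4 by positivity)) ?_ ?_ ?_ ?_ ?_ ?_
    · filter_upwards [ball_mem_nhds z₀ (show 0 < ρ / 4 by positivity)] with z hz
      exact (hcontw z hz).aestronglyMeasurable
    · exact (hcontw z₀ (mem_ball_self (by positivity))).intervalIntegrable _ _
    · borelize E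
      borelize (E →L[ℂ] F)
      have h1 : Measurable fun θ : ℝ => fderiv ℂ f (z₀ + circleMap 0 c θ • v) :=
        (measurable_fderiv ℂ f).comp (by fun_prop : Continuous _).measurable
      have h2 : Measurable fun θ : ℝ => (1 / (circleMap 0 c θ - 0) ^ 2 : ℂ) := by
        have : Measurable (circleMap 0 c) := (continuous_circleMap 0 c).measurable
        fun_prop
      have h3 : Measurable (deriv (circleMap 0 c)) := measurable_deriv _
      exact (h3.stronglyMeasurable.smul
        (h2.stronglyMeasurable.smul h1.stronglyMeasurable)).aestronglyMeasurable
    · refine Eventually.of_forall fun θ _ z hz => ?_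
      simp only [G', norm_smul]
      have := hfd _ (hmem z hz _ (hcirc θ))
      have e1 : ‖deriv (circleMap 0 c) θ‖ = c := by simp [abs_of_pos hc]
      have e2 : ‖(1 / (circleMap 0 c θ - 0) ^ 2 : ℂ)‖ = 1 / c ^ 2 := by simp
      rw [e1, e2]
      gcongr
    · exact intervalIntegrable_const
    · refine Eventually.of_forall fun θ _ z hz => ?_
      have h1 : HasFDerivAt (fun z => f (z + circleMap 0 c θ • v))
          (fderiv ℂ f (z + circleMap 0 c θ • v)) z :=
        (hasFDerivAt_comp_add_right _).2 (hdiff _ (hmem' z hz _ (hcirc θ))).hasFDerivAt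
      exact (h1.const_smul _).const_smul _
  refine (key.differentiableAt.const_smul (2 * Real.pi * I : ℂ)⁻¹).congr_of_eventuallyEq ?_
  filter_upwards [ball_mem_nhds z₀ (show 0 < ρ / 4 by positivity)] with z hz
  exact hformula z hz

/-- A holomorphic map is continuously differentiable. -/
lemma contDiffAt_one_of_differentiableOn_complex {E F : Type*}
    [NormedAddCommGroup E] [NormedSpace ℂ E] [FiniteDimensional ℂ E]
    [NormedAddCommGroup F] [NormedSpace ℂ F] [FiniteDimensional ℂ F]
    {f : E → F} {U : Set E} (hf : DifferentiableOn ℂ f U) (hU : IsOpen U) {z : E} (hz : z ∈ U) :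
    ContDiffAt ℂ 1 f z :=
  contDiffAt_one_iff.2 ⟨fderiv ℂ f, U, hU.mem_nhds hz,
    continuousOn_clm_apply.2 fun v => (differentiableOn_fderiv_apply hf hU v).continuousOn,
    fun _ hw => (hf.differentiableAt (hU.mem_nhds hw)).hasFDerivAt⟩

/-- Determinants of holomorphic families of endomorphisms are holomorphic. -/
lemma differentiableOn_clm_det {E : Type*}
    [NormedAddCommGroup E] [NormedSpace ℂ E] [FiniteDimensional ℂ E]
    {X : Type*} [NormedAddCommGroup X] [NormedSpace ℂ X]
    {A : X → E →L[ℂ] E} {U : Set X} (hA : ∀ v, DifferentiableOn ℂ (fun z => A z v) U) :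
    DifferentiableOn ℂ (fun z => (A z).det) U := by
  let b := Module.finBasis ℂ E
  have h : ∀ z, (A z).det = ∑ σ : Equiv.Perm (Fin (Module.finrank ℂ E)),
      Equiv.Perm.sign σ • ∏ i, (LinearMap.toContinuousLinearMap (b.coord (σ i))) (A z (b i)) := by
    intro z
    rw [ContinuousLinearMap.det, ← LinearMap.det_toMatrix b, Matrix.det_apply]
    simp [LinearMap.toMatrix_apply]
  simp_rw [h]
  refine DifferentiableOn.fun_sum fun σ _ => ?_
  refine DifferentiableOn.const_smul ?_ _
  intro z hz
  exact (HasFDerivWithinAt.finsetProd fun i _ =>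
    ((ContinuousLinearMap.differentiable _).comp_differentiableOn
      (hA (b i)) z hz).hasFDerivWithinAt).differentiableWithinAt

/-- A Hurwitz-type estimate: if holomorphic functions `k i` converge on a circle to a function
without zeros there, then those `k i` that have no zeros in the closed disc are bounded below at
the centre. -/
lemma exists_pos_eventually_le_norm_of_ne_zero {ι : Type*} {l : Filter ι} {k : ι → ℂ → ℂ}
    {k₀ : ℂ → ℂ} {r : ℝ} (hr : 0 < r)
    (hk : ∀ᶠ i in l, DifferentiableOn ℂ (k i) (closedBall 0 r))
    (hlim : ∀ t ∈ sphere (0 : ℂ) r,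
      Tendsto (fun q : ι × ℂ => k q.1 q.2) (l ×ˢ 𝓝 t) (𝓝 (k₀ t)))
    (h0 : ∀ t ∈ sphere (0 : ℂ) r, k₀ t ≠ 0) :
    ∃ δ > 0, ∀ᶠ i in l, (∀ t ∈ closedBall (0 : ℂ) r, k i t ≠ 0) → δ ≤ ‖k i 0‖ := by
  obtain ⟨δ, hδ, hev⟩ : ∃ δ > 0, ∀ᶠ i in l, ∀ t ∈ sphere (0 : ℂ) r, δ ≤ ‖k i t‖ := by
    refine (isCompact_sphere (0 : ℂ) r).induction_on
      (p := fun S => ∃ δ > 0, ∀ᶠ i in l, ∀ t ∈ S, δ ≤ ‖k i t‖) ?_ ?_ ?_ ?_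
    · exact ⟨1, one_pos, by simp⟩
    · rintro S T hST ⟨δ, hδ, h⟩
      exact ⟨δ, hδ, h.mono fun i hi t ht => hi t (hST ht)⟩
    · rintro S T ⟨δ, hδ, h⟩ ⟨δ', hδ', h'⟩
      refine ⟨min δ δ', lt_min hδ hδ', ?_⟩
      filter_upwards [h, h'] with i hi hi' t ht
      rcases ht with ht | ht
      · exact (min_le_left _ _).trans (hi t ht)
      · exact (min_le_right _ _).trans (hi' t ht)
    · intro t ht
      have hpos : 0 < ‖k₀ t‖ := norm_pos_iff.2 (h0 t ht)
      have h1 : ∀ᶠ q : ι × ℂ in l ×ˢ 𝓝 t, ‖k₀ t‖ / 2 < ‖k q.1 q.2‖ :=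
        (hlim t ht).norm.eventually_const_lt (by linarith)
      obtain ⟨P, hP, Q, hQ, hPQ⟩ := eventually_prod_iff.1 h1
      exact ⟨{s | Q s}, mem_nhdsWithin_of_mem_nhds hQ, ‖k₀ t‖ / 2, by positivity,
        hP.mono fun i hi s hs => (hPQ hi hs).le⟩
  refine ⟨δ, hδ, ?_⟩
  filter_upwards [hk, hev] with i hd hle hne
  have hdc : DiffContOnCl ℂ (fun t => (k i t)⁻¹) (ball 0 r) :=
    DifferentiableOn.diffContOnCl (by
      rw [closure_ball _ hr.ne']
      exact hd.inv hne)
  have h1 := Complex.norm_le_of_forall_mem_frontier_norm_le (C := δ⁻¹) isBounded_ball hdc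
    (fun t ht => by
      rw [frontier_ball _ hr.ne'] at ht
      rw [norm_inv]
      exact inv_anti₀ hδ (hle t ht))
    (subset_closure (mem_ball_self hr))
  rw [norm_inv] at h1
  exact (inv_le_inv₀ (norm_pos_iff.2 (hne 0 (by simp [hr.le]))) hδ).1 h1

/-- An injective holomorphic function of one variable has nonvanishing derivative. -/
lemma deriv_ne_zero_of_injOn_ball {k : ℂ → ℂ} {r : ℝ} (hr : 0 < r)
    (hk : DifferentiableOn ℂ k (ball 0 r)) (hinj : InjOn k (ball 0 r)) : deriv k 0 ≠ 0 := by
  have han : AnalyticOnNhd ℂ k (ball 0 r) := hk.analyticOnNhd isOpen_ball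
  have hnc : ∀ z ∈ ball (0 : ℂ) r, ¬ ∀ᶠ w in 𝓝 z, k w = k z := by
    intro z hz h
    have h1 : ∀ᶠ w in 𝓝 z, w = z := by
      filter_upwards [h, isOpen_ball.mem_nhds hz] with w hw hwr using hinj hwr hz hw
    have h2 : ∀ᶠ w in 𝓝[≠] z, False := by
      filter_upwards [h1.filter_mono nhdsWithin_le_nhds, self_mem_nhdsWithin] with w hw hw'
      exact hw' hw
    exact (eventually_false_iff_eq_bot.1 h2 |> NeBot.ne inferInstance)
  have hmap : ∀ z ∈ ball (0 : ℂ) r, 𝓝 (k z) ≤ map k (𝓝 z) := fun z hz =>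
    (han z hz).eventually_constant_or_nhds_le_map_nhds.resolve_left (hnc z hz)
  have h0 : (0 : ℂ) ∈ ball (0 : ℂ) r := mem_ball_self hr
  have hder : ∀ᶠ z in 𝓝[≠] (0 : ℂ), deriv k z ≠ 0 := by
    refine (han 0 h0).deriv.eventually_eq_zero_or_eventually_ne_zero.resolve_left fun h => ?_
    obtain ⟨ρ, hρ, hsub⟩ := Metric.eventually_nhds_iff_ball.1
      (h.and (isOpen_ball.mem_nhds h0))
    refine hnc 0 h0 ?_
    filter_upwards [ball_mem_nhds (0 : ℂ) hρ] with w hw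
    exact isOpen_ball.is_const_of_deriv_eq_zero (convex_ball _ _).isPreconnected
      (hk.mono fun y hy => (hsub y hy).2) (fun y hy => (hsub y hy).1) hw (mem_ball_self hρ)
  obtain ⟨ρ, hρ, hsub⟩ := Metric.eventually_nhds_iff_ball.1
    ((eventually_nhdsWithin_iff.1 hder).and (isOpen_ball.mem_nhds h0))
  have hsub' : ball (0 : ℂ) ρ ⊆ ball 0 r := fun y hy => (hsub y hy).2
  set D := ball (0 : ℂ) ρ
  have h0D : (0 : ℂ) ∈ D := mem_ball_self hρ
  have hDo : IsOpen D := isOpen_ball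
  let g := Function.invFunOn k D
  have hgk : ∀ z ∈ D, g (k z) = z := fun z hz => (hinj.mono hsub').leftInvOn_invFunOn hz
  have himg : ∀ z ∈ D, ∀ N ∈ 𝓝 z, k '' N ∈ 𝓝 (k z) := fun z hz N hN =>
    hmap z (hsub' hz) (image_mem_map hN)
  have hgc : ∀ z ∈ D, ContinuousAt g (k z) := by
    intro z hz N hN
    rw [hgk z hz] at hN
    rw [Filter.mem_map]
    refine mem_of_superset (himg z hz _ (inter_mem hN (hDo.mem_nhds hz))) ?_
    rintro _ ⟨w, hw, rfl⟩
    rw [mem_preimage, hgk w hw.2]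
    exact hw.1
  have hgd : DifferentiableOn ℂ g (k '' D \ {k 0}) := by
    rintro _ ⟨⟨z, hz, rfl⟩, hz0⟩
    have hz0' : z ≠ 0 := fun h => hz0 (by simp [h])
    refine DifferentiableAt.differentiableWithinAt ?_
    have h1 : HasDerivAt k (deriv k z) (g (k z)) := by
      rw [hgk z hz]
      exact (hk.differentiableAt (isOpen_ball.mem_nhds (hsub' hz))).hasDerivAt
    refine (h1.of_local_left_inverse (hgc z hz) ((hsub z hz).1 hz0') ?_).differentiableAt
    filter_upwards [himg z hz D (hDo.mem_nhds hz)]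
    rintro _ ⟨w, hw, rfl⟩
    rw [hgk w hw]
  have hnhds : k '' D ∈ 𝓝 (k 0) := himg 0 h0D D (hDo.mem_nhds h0D)
  have hgd0 : DifferentiableAt ℂ g (k 0) :=
    ((Complex.differentiableOn_compl_singleton_and_continuousAt_iff hnhds).1
      ⟨hgd, hgc 0 h0D⟩).differentiableAt hnhds
  have hcomp : HasDerivAt (g ∘ k) (deriv g (k 0) * deriv k 0) 0 :=
    hgd0.hasDerivAt.comp 0 (hk.differentiableAt (isOpen_ball.mem_nhds h0)).hasDerivAt
  have hid : HasDerivAt (g ∘ k) 1 0 := by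
    refine (hasDerivAt_id (0 : ℂ)).congr_of_eventuallyEq ?_
    filter_upwards [hDo.mem_nhds h0D] with z hz using hgk z hz
  intro h
  have := hcomp.unique hid
  simp [h] at this

/-- A holomorphic function with nonzero differential at `p` becomes affine after a local
holomorphic change of coordinates centred at `p`. -/
lemma exists_straightening {E : Type*} [NormedAddCommGroup E] [NormedSpace ℂ E]
    [FiniteDimensional ℂ E] {h : E → ℂ} {U : Set E} (hU : IsOpen U)
    (hh : DifferentiableOn ℂ h U) {p : E} (hp : p ∈ U) (hne : fderiv ℂ h p ≠ 0) :
    ∃ (G : E → E) (W : Set E), IsOpen W ∧ 0 ∈ W ∧ G 0 = p ∧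
      HasFDerivAt G (ContinuousLinearMap.id ℂ E) 0 ∧ DifferentiableOn ℂ G W ∧ InjOn G W ∧
      MapsTo G W U ∧ ∀ w ∈ W, h (G w) = h p + fderiv ℂ h p w := by
  have : CompleteSpace E := FiniteDimensional.complete ℂ E
  set L := fderiv ℂ h p
  obtain ⟨v, hv⟩ : ∃ v, L v = 1 := by
    obtain ⟨v, hv⟩ := DFunLike.ne_iff.1 hne
    exact ⟨(L v)⁻¹ • v, by simpa using inv_mul_cancel₀ hv⟩
  let Ψ : E → E := fun z => z + (h z - L z) • v
  have hΨd : HasFDerivAt Ψ ((ContinuousLinearEquiv.refl ℂ E : E ≃L[ℂ] E) : E →L[ℂ] E) p := by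
    have h1 : HasFDerivAt h L p := (hh.differentiableAt (hU.mem_nhds hp)).hasFDerivAt
    have h2 := (hasFDerivAt_id (𝕜 := ℂ) p).add ((h1.sub L.hasFDerivAt).smul_const v)
    refine h2.congr_fderiv ?_
    ext; simp
  have hΨc : ContDiffAt ℂ 1 Ψ p :=
    contDiffAt_id.add (((contDiffAt_one_of_differentiableOn_complex hh hU hp).sub
      L.contDiff.contDiffAt).smul contDiffAt_const)
  let e := hΨc.toOpenPartialHomeomorph Ψ hΨd one_ne_zero
  have heΨ : ∀ z, e z = Ψ z := fun _ => rfl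
  have hps : p ∈ e.source := hΨc.mem_toOpenPartialHomeomorph_source hΨd one_ne_zero
  have hpt : Ψ p ∈ e.target := hΨc.image_mem_toOpenPartialHomeomorph_target hΨd one_ne_zero
  have hsymm : e.symm (Ψ p) = p := e.left_inv hps
  have hec : ContDiffAt ℂ 1 e.symm (Ψ p) :=
    e.contDiffAt_symm hpt (by rw [hsymm]; exact hΨd) (by rw [hsymm]; exact hΨc)
  have hed : HasFDerivAt e.symm (ContinuousLinearMap.id ℂ E) (Ψ p) :=
    e.hasFDerivAt_symm (f' := ContinuousLinearEquiv.refl ℂ E) hpt (by rw [hsymm]; exact hΨd)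
  have hev : ∀ᶠ y in 𝓝 (Ψ p), y ∈ e.target ∧ DifferentiableAt ℂ e.symm y ∧ e.symm y ∈ U := by
    refine Filter.Eventually.and (e.open_target.mem_nhds hpt)
      (((hec.eventually (by simp)).mono fun y hy => hy.differentiableAt one_ne_zero).and ?_)
    exact hed.continuousAt (by rw [hsymm]; exact hU.mem_nhds hp)
  obtain ⟨V, hVsub, hVo, hVp⟩ := _root_.mem_nhds_iff.1 hev
  refine ⟨fun w => e.symm (Ψ p + w), (fun w => Ψ p + w) ⁻¹' V, hVo.preimage (by fun_prop),
    by simpa using hVp, by simpa using hsymm, ?_, ?_, ?_, ?_, ?_⟩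
  · rw [hasFDerivAt_comp_add_left]
    simpa using hed
  · intro w hw
    refine DifferentiableAt.differentiableWithinAt ?_
    exact ((hasFDerivAt_comp_add_left _).2 (hVsub hw).2.1.hasFDerivAt).differentiableAt
  · intro w hw w' hw' heq
    simpa using e.symm.injOn (hVsub hw).1 (hVsub hw').1 heq
  · exact fun w hw => (hVsub hw).2.2
  · intro w hw
    have hLΨ : ∀ z, L (Ψ z) = h z := fun z => by simp [Ψ, hv]
    have h1 : Ψ (e.symm (Ψ p + w)) = Ψ p + w := e.right_inv (hVsub hw).1
    rw [← hLΨ, h1, map_add, hLΨ]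

/-- If a holomorphic function `J` vanishes at a point of a ball without vanishing identically on
the ball, some holomorphic function vanishing on the zero set of `J` has nonzero differential at
a zero of `J`. -/
lemma exists_fderiv_ne_zero_of_vanishing {E : Type*} [NormedAddCommGroup E] [NormedSpace ℂ E]
    [FiniteDimensional ℂ E] {J : E → ℂ} {U : Set E} (hU : IsOpen U)
    (hJ : DifferentiableOn ℂ J U) {p₀ q : E} {r : ℝ} (hball : ball p₀ r ⊆ U)
    (hq : q ∈ ball p₀ r) (hp0 : J p₀ = 0) (hJq : J q ≠ 0) :
    ∃ ψ : E → ℂ, DifferentiableOn ℂ ψ U ∧ (∀ z ∈ U, J z = 0 → ψ z = 0) ∧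
      ∃ p ∈ U, J p = 0 ∧ fderiv ℂ ψ p ≠ 0 := by
  by_contra! hcon
  have hr : 0 < r := pos_of_mem_ball hq
  set v := q - p₀ with hv
  have hv0 : 0 < ‖v‖ := by
    rw [norm_pos_iff, hv, sub_ne_zero]
    rintro rfl
    exact hJq hp0
  let D : ℕ → E → ℂ := fun i => Nat.rec J (fun _ d z => fderiv ℂ d z v) i
  have hDsucc : ∀ i z, D (i + 1) z = fderiv ℂ (D i) z v := fun _ _ => rfl
  have hD : ∀ i, DifferentiableOn ℂ (D i) U ∧ ∀ z ∈ U, J z = 0 → D i z = 0 := by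
    intro i
    induction i with
    | zero => exact ⟨hJ, fun z _ h => h⟩
    | succ i ih =>
      refine ⟨differentiableOn_fderiv_apply ih.1 hU v, fun z hz h => ?_⟩
      rw [hDsucc, hcon (D i) ih.1 ih.2 z hz h]
      rfl
  have hmem : ∀ t ∈ ball (0 : ℂ) (r / ‖v‖), p₀ + t • v ∈ U := by
    intro t ht
    refine hball ?_
    rw [mem_ball_zero_iff, lt_div_iff₀ hv0] at ht
    simpa [mem_ball, dist_eq_norm, norm_smul] using ht
  have hline : ∀ i, ∀ t ∈ ball (0 : ℂ) (r / ‖v‖),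
      HasDerivAt (fun t : ℂ => D i (p₀ + t • v)) (D (i + 1) (p₀ + t • v)) t := by
    intro i t ht
    have h2 : HasDerivAt (fun t : ℂ => p₀ + t • v) v t := by
      simpa using ((hasDerivAt_id t).smul_const v).const_add p₀
    exact ((hD i).1.differentiableAt (hU.mem_nhds (hmem t ht))).hasFDerivAt.comp_hasDerivAt t h2
  have hiter : ∀ i, ∀ t ∈ ball (0 : ℂ) (r / ‖v‖),
      iteratedDeriv i (fun t : ℂ => J (p₀ + t • v)) t = D i (p₀ + t • v) := by
    intro i
    induction i with
    | zero => intro t _; rfl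
    | succ i ih =>
      intro t ht
      rw [iteratedDeriv_succ, ← (hline i t ht).deriv]
      refine EventuallyEq.deriv_eq ?_
      filter_upwards [isOpen_ball.mem_nhds ht] with s hs using ih s hs
  have h1 : (1 : ℂ) ∈ ball (0 : ℂ) (r / ‖v‖) := by
    rw [mem_ball_zero_iff, lt_div_iff₀ hv0]
    simpa [hv, mem_ball, dist_eq_norm] using hq
  have hsum := Complex.hasSum_taylorSeries_on_ball
    (f := fun t : ℂ => J (p₀ + t • v)) (c := 0) (r := r / ‖v‖) (z := 1)
    (fun t ht => (hline 0 t ht).differentiableAt.differentiableWithinAt) h1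
  have h0 : (0 : ℂ) ∈ ball (0 : ℂ) (r / ‖v‖) := mem_ball_self (by positivity)
  have hp0U : p₀ ∈ U := hball (mem_ball_self hr)
  have hz : ∀ n, iteratedDeriv n (fun t : ℂ => J (p₀ + t • v)) 0 = 0 := fun n => by
    rw [hiter n 0 h0]
    simpa using (hD n).2 p₀ hp0U hp0
  simp only [hz, smul_zero] at hsum
  have := hsum.unique hasSum_zero
  exact hJq (by simpa [hv] using this)

/-- If the zero set of a holomorphic function `J` is nonempty and has empty interior in
dimension at least two, then it contains two distinct points at which every holomorphic map with
differential vanishing on that set takes the same value. -/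
lemma not_injOn_of_fderiv_eq_zero_on_zeros {E F : Type*} [NormedAddCommGroup E] [NormedSpace ℂ E]
    [FiniteDimensional ℂ E] [NormedAddCommGroup F] [NormedSpace ℂ F]
    (hdim : 2 ≤ Module.finrank ℂ E) {J : E → ℂ} {f : E → F} {U : Set E} (hU : IsOpen U)
    (hJ : DifferentiableOn ℂ J U) (hf : DifferentiableOn ℂ f U)
    (hZ : ∀ z ∈ U, J z = 0 → fderiv ℂ f z = 0)
    {p₀ q : E} {r : ℝ} (hball : ball p₀ r ⊆ U)
    (hq : q ∈ ball p₀ r) (hp0 : J p₀ = 0) (hJq : J q ≠ 0) : ¬ InjOn f U := by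
  intro hinj
  obtain ⟨ψ, hψ, hψZ, p, hp, hJp, hψp⟩ :=
    exists_fderiv_ne_zero_of_vanishing hU hJ hball hq hp0 hJq
  obtain ⟨G, W, hWo, h0W, hG0, -, hGd, hGinj, hGU, hGψ⟩ := exists_straightening hU hψ hp hψp
  set L := fderiv ℂ ψ p
  obtain ⟨v, hv⟩ : ∃ v, L v = 1 := by
    obtain ⟨v, hv⟩ := DFunLike.ne_iff.1 hψp
    exact ⟨(L v)⁻¹ • v, by simpa using inv_mul_cancel₀ hv⟩
  obtain ⟨u, huL, hu0⟩ : ∃ u, L u = 0 ∧ u ≠ 0 := by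
    have h1 : LinearMap.ker (L : E →ₗ[ℂ] ℂ) ≠ ⊥ :=
      LinearMap.ker_ne_bot_of_finrank_lt (by rw [Module.finrank_self]; omega)
    obtain ⟨u, hu, hu0⟩ := Submodule.exists_mem_ne_zero_of_ne_bot h1
    exact ⟨u, hu, hu0⟩
  let P : ℂ × ℂ → E := fun a => a.1 • u + a.2 • v
  have hP : Continuous P := by fun_prop
  obtain ⟨ρ, hρ, hρW⟩ : ∃ ρ > 0, ∀ a ∈ ball (0 : ℂ × ℂ) ρ, P a ∈ W := by
    have : ∀ᶠ a in 𝓝 (0 : ℂ × ℂ), P a ∈ W :=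
      hP.continuousAt (hWo.mem_nhds (by simpa [P] using h0W))
    exact Metric.eventually_nhds_iff_ball.1 this
  have hst : ∀ s t : ℂ, ‖s‖ < ρ → ‖t‖ < ρ → P (s, t) ∈ W := fun s t hs ht =>
    hρW _ (by simp [Prod.norm_def, hs, ht])
  have hLP : ∀ s t : ℂ, L (P (s, t)) = t := fun s t => by simp [P, huL, hv]
  have hψp0 : ψ p = 0 := hψZ p hp hJp
  have hzero : ∀ s t : ℂ, ‖s‖ < ρ → ‖t‖ < ρ → J (G (P (s, t))) = 0 → t = 0 := by
    intro s t hs ht h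
    have h1 := hGψ _ (hst s t hs ht)
    rw [hψp0, hLP, hψZ _ (hGU (hst s t hs ht)) h] at h1
    simpa using h1.symm
  have hJG : DifferentiableOn ℂ (fun w => J (G w)) W := hJ.comp hGd hGU
  have hKat : ∀ s t : ℂ, ‖s‖ < ρ → ‖t‖ < ρ → ContinuousAt (fun a => J (G (P a))) (s, t) :=
    fun s t hs ht => ContinuousAt.comp (g := fun w => J (G w))
      (hJG.differentiableAt (hWo.mem_nhds (hst s t hs ht))).continuousAt hP.continuousAt
  have hsmall : ∀ᶠ s in 𝓝 (0 : ℂ), ‖s‖ < ρ := by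
    filter_upwards [ball_mem_nhds (0 : ℂ) hρ] with s hs using by simpa using hs
  obtain ⟨δ, hδ, hev⟩ := exists_pos_eventually_le_norm_of_ne_zero (l := 𝓝 (0 : ℂ))
    (k := fun s t => J (G (P (s, t)))) (k₀ := fun t => J (G (P (0, t)))) (half_pos hρ)
    (by
      filter_upwards [hsmall] with s hs
      have hPd : Differentiable ℂ fun t : ℂ => P (s, t) := by
        simp only [P]
        fun_prop
      refine DifferentiableOn.comp (g := fun w => J (G w)) (f := fun t : ℂ => P (s, t)) (t := W)
        hJG hPd.differentiableOn fun t ht => ?_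
      rw [mem_closedBall_zero_iff] at ht
      exact hst s t hs (by linarith))
    (by
      intro t ht
      rw [mem_sphere_zero_iff_norm] at ht
      rw [← nhds_prod_eq]
      exact hKat 0 t (by simpa using hρ) (by linarith))
    (by
      intro t ht h
      rw [mem_sphere_zero_iff_norm] at ht
      have := hzero 0 t (by simpa using hρ) (by linarith) h
      rw [this, norm_zero] at ht
      linarith)
  have hlt : ∀ᶠ s in 𝓝 (0 : ℂ), ‖J (G (P (s, 0)))‖ < δ := by
    have h1 : ContinuousAt (fun s : ℂ => J (G (P (s, 0)))) 0 :=
      ContinuousAt.comp (f := fun s : ℂ => (s, (0 : ℂ))) (g := fun a => J (G (P a)))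
        (hKat 0 0 (by simpa using hρ) (by simpa using hρ)) (by fun_prop)
    refine h1.norm.eventually_lt_const ?_
    simpa [P, hG0, hJp] using hδ
  have hvan : ∀ᶠ s in 𝓝 (0 : ℂ), ‖s‖ < ρ ∧ J (G (P (s, 0))) = 0 := by
    filter_upwards [hsmall, hev, hlt] with s hs h1 h2
    refine ⟨hs, ?_⟩
    by_contra hne
    refine absurd (h1 fun t ht h => ?_) (not_le.2 h2)
    rw [mem_closedBall_zero_iff] at ht
    rw [hzero s t hs (by linarith) h] at h
    exact hne h
  obtain ⟨η, hη, hηv⟩ := Metric.eventually_nhds_iff_ball.1 hvan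
  have hd0 : ∀ s ∈ ball (0 : ℂ) η, HasDerivAt (fun s : ℂ => f (G (P (s, 0)))) 0 s := by
    intro s hs
    have hW := hst s 0 (hηv s hs).1 (by simpa using hρ)
    have hPs : HasDerivAt (fun s : ℂ => P (s, 0)) u s := by
      simpa [P] using (hasDerivAt_id s).smul_const u
    have h2 := (hGd.differentiableAt (hWo.mem_nhds hW)).hasFDerivAt.comp_hasDerivAt s hPs
    have h3 := (hf.differentiableAt (hU.mem_nhds (hGU hW))).hasFDerivAt.comp_hasDerivAt s h2
    rw [hZ _ (hGU hW) (hηv s hs).2] at h3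
    exact h3
  have hm : ((η / 2 : ℝ) : ℂ) ∈ ball (0 : ℂ) η := by
    rw [mem_ball_zero_iff, Complex.norm_real, Real.norm_of_nonneg (by positivity)]
    linarith
  have h0 : (0 : ℂ) ∈ ball (0 : ℂ) η := mem_ball_self hη
  have hconst := isOpen_ball.is_const_of_deriv_eq_zero (convex_ball (0 : ℂ) η).isPreconnected
    (fun s hs => (hd0 s hs).differentiableAt.differentiableWithinAt)
    (fun s hs => (hd0 s hs).deriv) hm h0
  have hW1 := hst _ 0 (hηv _ hm).1 (by simpa using hρ)
  have hW0 := hst _ 0 (hηv _ h0).1 (by simpa using hρ)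
  have := hGinj hW1 hW0 (hinj (hGU hW1) (hGU hW0) hconst)
  simp [P, hu0, hη.ne'] at this

/-- Inductive step for the injectivity of differentials: if injective holomorphic maps between
spaces of dimension `n` have injective differentials, then an injective holomorphic map between
spaces of dimension `n + 1` has injective differential wherever the differential is nonzero. -/
lemma injective_fderiv_of_ne_zero {n : ℕ} {E : Type u} {F : Type v} [NormedAddCommGroup E]
    [NormedSpace ℂ E] [FiniteDimensional ℂ E] [NormedAddCommGroup F] [NormedSpace ℂ F]
    [FiniteDimensional ℂ F]
    (ih : ∀ {E' : Type u} {F' : Type v} [NormedAddCommGroup E'] [NormedSpace ℂ E']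
      [FiniteDimensional ℂ E'] [NormedAddCommGroup F'] [NormedSpace ℂ F'] [FiniteDimensional ℂ F']
      {U : Set E'} {f : E' → F'}, Module.finrank ℂ E' = n → Module.finrank ℂ F' = n →
      IsOpen U → DifferentiableOn ℂ f U → InjOn f U → ∀ p ∈ U, Function.Injective (fderiv ℂ f p))
    (hE : Module.finrank ℂ E = n + 1) (hF : Module.finrank ℂ F = n + 1) {U : Set E} {f : E → F}
    (hU : IsOpen U) (hf : DifferentiableOn ℂ f U) (hinj : InjOn f U) {p : E} (hp : p ∈ U)
    (hne : fderiv ℂ f p ≠ 0) : Function.Injective (fderiv ℂ f p) := by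
  obtain ⟨v, hv⟩ := DFunLike.ne_iff.1 hne
  obtain ⟨l, hl⟩ := SeparatingDual.exists_ne_zero (R := ℂ) (by simpa using hv)
  have hfp := (hf.differentiableAt (hU.mem_nhds hp)).hasFDerivAt
  have hh : DifferentiableOn ℂ (fun z => l (f z)) U := l.differentiable.comp_differentiableOn hf
  have hhp : fderiv ℂ (fun z => l (f z)) p = l ∘L fderiv ℂ f p :=
    (l.hasFDerivAt.comp p hfp).fderiv
  have hL0 : l ∘L fderiv ℂ f p ≠ 0 := fun h => hl (by simpa using DFunLike.congr_fun h v)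
  have hl0 : l ≠ 0 := fun h => hl (by simp [h])
  obtain ⟨G, W, hWo, h0W, hG0, hG', hGd, hGinj, hGU, hGl⟩ :=
    exists_straightening hU hh hp (hhp ▸ hL0)
  rw [hhp] at hGl
  set L := l ∘L fderiv ℂ f p
  let E' : Submodule ℂ E := LinearMap.ker (L : E →ₗ[ℂ] ℂ)
  let F' : Submodule ℂ F := LinearMap.ker (l : F →ₗ[ℂ] ℂ)
  have hE' : Module.finrank ℂ E' = n := by
    have := Module.Dual.finrank_ker_add_one_of_ne_zero (f := (L : E →ₗ[ℂ] ℂ))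
      (fun h => hL0 (ContinuousLinearMap.coe_injective h))
    rw [hE] at this
    exact Nat.succ_injective this
  have hF' : Module.finrank ℂ F' = n := by
    have := Module.Dual.finrank_ker_add_one_of_ne_zero (f := (l : F →ₗ[ℂ] ℂ))
      (fun h => hl0 (ContinuousLinearMap.coe_injective h))
    rw [hF] at this
    exact Nat.succ_injective this
  obtain ⟨π₀, hπ₀⟩ := LinearMap.exists_leftInverse_of_injective F'.subtype F'.ker_subtype
  let π : F →L[ℂ] F' := LinearMap.toContinuousLinearMap π₀
  have hπ : ∀ y : F', π y = y := fun y => DFunLike.congr_fun hπ₀ y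
  have hd : DifferentiableOn ℂ (fun y : E' => π (f (G y))) (E'.subtypeL ⁻¹' W) :=
    π.differentiable.comp_differentiableOn
      ((hf.comp hGd hGU).comp E'.subtypeL.differentiable.differentiableOn fun _ h => h)
  have hi : InjOn (fun y : E' => π (f (G y))) (E'.subtypeL ⁻¹' W) := by
    intro y hy z hz hyz
    have hly : l (f (G y)) = l (f p) := by
      rw [hGl y hy, show L y = 0 from y.2, add_zero]
    have hlz : l (f (G z)) = l (f p) := by
      rw [hGl z hz, show L z = 0 from z.2, add_zero]
    have hmem : f (G y) - f (G z) ∈ F' := by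
      change l (f (G y) - f (G z)) = 0
      rw [map_sub, hly, hlz, sub_self]
    have h1 := hπ ⟨_, hmem⟩
    have h2 : π (f (G y) - f (G z)) = 0 := by
      rw [map_sub, sub_eq_zero]
      exact hyz
    rw [h2] at h1
    have h3 : f (G y) = f (G z) := sub_eq_zero.1 (congrArg Subtype.val h1).symm
    exact Subtype.ext (hGinj hy hz (hinj (hGU hy) (hGU hz) h3))
  have key := ih hE' hF' (hWo.preimage E'.subtypeL.continuous) hd hi 0 h0W
  have hfG : HasFDerivAt (fun w => f (G w)) (fderiv ℂ f p) 0 := by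
    rw [← hG0] at hfp
    have := HasFDerivAt.comp (g := f) (0 : E) hfp hG'
    rwa [hG0, ContinuousLinearMap.comp_id] at this
  have hder : HasFDerivAt (fun y : E' => π (f (G y))) (π ∘L fderiv ℂ f p ∘L E'.subtypeL) 0 :=
    π.hasFDerivAt.comp (0 : E')
      (HasFDerivAt.comp (g := fun w => f (G w)) (0 : E') hfG E'.subtypeL.hasFDerivAt)
  rw [hder.fderiv] at key
  refine (injective_iff_map_eq_zero _).2 fun u hu => ?_
  have huE : u ∈ E' := by
    change l (fderiv ℂ f p u) = 0
    rw [hu, map_zero]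
  have := (injective_iff_map_eq_zero _).1 key ⟨u, huE⟩ (by simp [hu])
  exact congrArg Subtype.val this

/-- In dimension one, an injective holomorphic map has nonzero differential. -/
lemma fderiv_ne_zero_of_injOn_of_finrank_eq_one {E F : Type*} [NormedAddCommGroup E]
    [NormedSpace ℂ E] [FiniteDimensional ℂ E] [NormedAddCommGroup F] [NormedSpace ℂ F]
    [FiniteDimensional ℂ F] (hE : Module.finrank ℂ E = 1) (hF : Module.finrank ℂ F = 1)
    {U : Set E} {f : E → F} (hU : IsOpen U) (hf : DifferentiableOn ℂ f U) (hinj : InjOn f U)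
    {p : E} (hp : p ∈ U) : fderiv ℂ f p ≠ 0 := by
  intro h0
  have m : F ≃L[ℂ] ℂ := ContinuousLinearEquiv.ofFinrankEq (by rw [hF, Module.finrank_self])
  have e : ℂ ≃L[ℂ] E := ContinuousLinearEquiv.ofFinrankEq (by rw [hE, Module.finrank_self])
  have hev : ∀ᶠ t in 𝓝 (0 : ℂ), p + e t ∈ U :=
    ContinuousAt.eventually_mem (f := fun t => p + e t) (by fun_prop)
      (hU.mem_nhds (by simpa using hp))
  obtain ⟨r, hr, hrU⟩ := Metric.eventually_nhds_iff_ball.1 hev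
  have hline : Differentiable ℂ fun t : ℂ => p + e t := by fun_prop
  refine deriv_ne_zero_of_injOn_ball (k := fun t => m (f (p + e t))) hr
    (m.differentiable.comp_differentiableOn (hf.comp hline.differentiableOn hrU))
    (fun s hs t ht hst => ?_) ?_
  · exact e.injective (add_left_cancel (hinj (hrU s hs) (hrU t ht) (m.injective hst)))
  · have h1 : HasFDerivAt f (0 : E →L[ℂ] F) (p + e 0) := by
      rw [map_zero, add_zero, ← h0]
      exact (hf.differentiableAt (hU.mem_nhds hp)).hasFDerivAt
    have h2 := m.hasFDerivAt.comp_hasDerivAt (0 : ℂ)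
      (HasFDerivAt.comp_hasDerivAt (l := f) (0 : ℂ) h1 (hline 0).hasDerivAt)
    simpa [Function.comp_def] using h2.deriv

/-- **Osgood's theorem**: an injective holomorphic map between spaces of equal finite dimension has
injective differential at every point. -/
theorem injective_fderiv_of_injOn {E : Type u} {F : Type v} [NormedAddCommGroup E]
    [NormedSpace ℂ E] [FiniteDimensional ℂ E] [NormedAddCommGroup F] [NormedSpace ℂ F]
    [FiniteDimensional ℂ F] (hEF : Module.finrank ℂ E = Module.finrank ℂ F) {U : Set E} {f : E → F}
    (hU : IsOpen U) (hf : DifferentiableOn ℂ f U) (hinj : InjOn f U) {p : E} (hp : p ∈ U) :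
    Function.Injective (fderiv ℂ f p) := by
  induction h : Module.finrank ℂ E generalizing E F with
  | zero =>
    have := Module.finrank_zero_iff.1 h
    exact Function.injective_of_subsingleton _
  | succ n ih =>
    have hF : Module.finrank ℂ F = n + 1 := hEF ▸ h
    have hdich : ∀ z ∈ U, fderiv ℂ f z ≠ 0 → Function.Injective (fderiv ℂ f z) := fun z hz =>
      injective_fderiv_of_ne_zero (fun h1 h2 hU' hf' hi' _ hp' =>
        ih (h1.trans h2.symm) hU' hf' hi' hp' h1) h hF hU hf hinj hz
    by_contra hnot
    have h0 : fderiv ℂ f p = 0 := by_contra fun h0 => hnot (hdich p hp h0)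
    rcases Nat.eq_zero_or_pos n with rfl | hn
    · exact fderiv_ne_zero_of_injOn_of_finrank_eq_one h hF hU hf hinj hp h0
    have e : F ≃L[ℂ] E := ContinuousLinearEquiv.ofFinrankEq hEF.symm
    let A : E → E →L[ℂ] E := fun z => (e : F →L[ℂ] E) ∘L fderiv ℂ f z
    have hA : DifferentiableOn ℂ (fun z => (A z).det) U := differentiableOn_clm_det fun v =>
      e.differentiable.comp_differentiableOn (differentiableOn_fderiv_apply hf hU v)
    have hZ : ∀ z ∈ U, (A z).det = 0 → fderiv ℂ f z = 0 := by
      intro z hz hdet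
      by_contra hz0
      refine (LinearMap.det_eq_zero_iff_ker_ne_bot.1 hdet) (LinearMap.ker_eq_bot.2 ?_)
      exact e.injective.comp (hdich z hz hz0)
    have hp0 : (A p).det = 0 := by
      refine LinearMap.det_eq_zero_iff_ker_ne_bot.2 fun hker => hnot ?_
      exact Function.Injective.of_comp (LinearMap.ker_eq_bot.1 hker)
    obtain ⟨r, hr, hrU⟩ := Metric.isOpen_iff.1 hU p hp
    obtain ⟨q, hq, hq0⟩ : ∃ q ∈ ball p r, (A q).det ≠ 0 := by
      by_contra! hall
      have : Nontrivial E := Module.nontrivial_of_finrank_pos (R := ℂ) (by omega)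
      obtain ⟨v, hv, hv0⟩ : ∃ v ∈ ball p r, v ≠ p := by
        have := Module.punctured_nhds_neBot ℂ E p
        exact (Filter.Eventually.and (mem_nhdsWithin_of_mem_nhds (ball_mem_nhds p hr))
          self_mem_nhdsWithin : ∀ᶠ v in 𝓝[≠] p, v ∈ ball p r ∧ v ≠ p).exists
      refine hv0 (hinj (hrU hv) hp ?_)
      exact isOpen_ball.is_const_of_fderiv_eq_zero (𝕜 := ℂ) (convex_ball p r).isPreconnected
        (hf.mono hrU) (fun z hz => hZ z (hrU hz) (hall z hz)) hv (mem_ball_self hr)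
    exact not_injOn_of_fderiv_eq_zero_on_zeros (by omega) hU hA hf hZ hrU hq hp0 hq0 hinj

/-- Differentials of a locally uniformly convergent family of holomorphic maps converge jointly in
the index and the base point. -/
lemma tendsto_fderiv_of_tendstoLocallyUniformlyOn {ι E F : Type*} [NormedAddCommGroup E]
    [NormedSpace ℂ E] [FiniteDimensional ℂ E] [NormedAddCommGroup F] [NormedSpace ℂ F]
    [FiniteDimensional ℂ F] {l : Filter ι} {f : ι → E → F} {g : E → F} {U : Set E}
    (hU : IsOpen U) (hf : ∀ i, DifferentiableOn ℂ (f i) U) (hg : DifferentiableOn ℂ g U)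
    (hlim : TendstoLocallyUniformlyOn f g l U) {z : E} (hz : z ∈ U) :
    Tendsto (fun q : ι × E => fderiv ℂ (f q.1) q.2) (l ×ˢ 𝓝 z) (𝓝 (fderiv ℂ g z)) := by
  have : ProperSpace E := FiniteDimensional.proper ℂ E
  obtain ⟨r, hr, hrU⟩ := nhds_basis_closedBall.mem_iff.1 (hU.mem_nhds hz)
  have hunif := Metric.tendstoUniformlyOn_iff.1
    ((tendstoLocallyUniformlyOn_iff_forall_isCompact hU).1 hlim _ hrU (isCompact_closedBall z r))
  have hsub : ∀ y ∈ ball z (r / 2), ball y (r / 2) ⊆ closedBall z r := fun y hy =>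
    (ball_subset_ball' (by rw [mem_ball] at hy; linarith)).trans ball_subset_closedBall
  have hdiff : Tendsto (fun q : ι × E => fderiv ℂ (f q.1) q.2 - fderiv ℂ g q.2) (l ×ˢ 𝓝 z)
      (𝓝 0) := by
    refine Metric.tendsto_nhds.2 fun c hc => ?_
    filter_upwards [(hunif (c * r / 8) (by positivity)).prod_mk (ball_mem_nhds z (half_pos hr))]
      with q hq
    obtain ⟨hq₁, hq₂⟩ := hq
    have hy := hrU (hsub q.2 hq₂ (mem_ball_self (half_pos hr)))
    have hsubU : ball q.2 (r / 2) ⊆ U := (hsub q.2 hq₂).trans hrU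
    have hmaps : MapsTo (f q.1 - g) (ball q.2 (r / 2))
        (closedBall ((f q.1 - g) q.2) (c * r / 4)) := by
      intro w hw
      have h1 := hq₁ w (hsub q.2 hq₂ hw)
      have h2 := hq₁ q.2 (hsub q.2 hq₂ (mem_ball_self (half_pos hr)))
      rw [dist_comm, dist_eq_norm] at h1 h2
      rw [mem_closedBall, dist_eq_norm]
      refine (norm_sub_le _ _).trans ?_
      simp only [Pi.sub_apply]
      linarith
    have hbound := Complex.norm_fderiv_le_div_of_mapsTo_ball
      (((hf q.1).mono hsubU).sub (hg.mono hsubU)) hmaps (half_pos hr)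
    rw [fderiv_sub ((hf q.1).differentiableAt (hU.mem_nhds hy))
      (hg.differentiableAt (hU.mem_nhds hy))] at hbound
    rw [dist_zero_right]
    refine hbound.trans_lt ?_
    rw [div_lt_iff₀ (half_pos hr)]
    nlinarith [mul_pos hc hr]
  have hcont : Tendsto (fun q : ι × E => fderiv ℂ g q.2) (l ×ˢ 𝓝 z) (𝓝 (fderiv ℂ g z)) :=
    ((contDiffAt_one_of_differentiableOn_complex hg hU hz).continuousAt_fderiv
      one_ne_zero).tendsto.comp tendsto_snd
  simpa using hdiff.add hcont

/-- The inverse of an injective holomorphic map, on a ball around `f x` contained in the image,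
bounds the differential at `x` from below. -/
lemma norm_le_mul_norm_fderiv_of_injOn {E : Type*} [NormedAddCommGroup E] [NormedSpace ℂ E]
    [FiniteDimensional ℂ E] {f : E → E} {U : Set E} (hU : IsOpen U)
    (hf : DifferentiableOn ℂ f U) (hinj : InjOn f U) {x : E} (hx : x ∈ U) {R ε : ℝ} (hε : 0 < ε)
    (hUR : U ⊆ closedBall x R) (hball : ball (f x) ε ⊆ f '' U) (v : E) :
    ‖v‖ ≤ R / ε * ‖fderiv ℂ f x v‖ := by
  have : CompleteSpace E := FiniteDimensional.complete ℂ E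
  have : Nonempty E := ⟨x⟩
  set g := Function.invFunOn f U
  have hgf : LeftInvOn g f U := hinj.leftInvOn_invFunOn
  have hder : ∀ z ∈ U, ∃ e : E ≃L[ℂ] E, (e : E →L[ℂ] E) = fderiv ℂ f z ∧
      HasFDerivAt g (e.symm : E →L[ℂ] E) (f z) := by
    intro z hz
    have hdet : (fderiv ℂ f z).det ≠ 0 := fun h =>
      LinearMap.det_eq_zero_iff_ker_ne_bot.1 h
        (LinearMap.ker_eq_bot.2 (injective_fderiv_of_injOn rfl hU hf hinj hz))
    have hs := (contDiffAt_one_of_differentiableOn_complex hf hU hz).hasStrictFDerivAt one_ne_zero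
    rw [← ContinuousLinearMap.coe_toContinuousLinearEquivOfDetNeZero _ hdet] at hs
    exact ⟨_, ContinuousLinearMap.coe_toContinuousLinearEquivOfDetNeZero _ hdet,
      (hs.to_local_left_inverse
        (Filter.eventually_of_mem (hU.mem_nhds hz) fun _ h => hgf h)).hasFDerivAt⟩
  obtain ⟨e, he, hge⟩ := hder x hx
  have hgd : DifferentiableOn ℂ g (ball (f x) ε) := by
    intro w hw
    obtain ⟨z, hz, rfl⟩ := hball hw
    obtain ⟨e', -, h'⟩ := hder z hz
    exact h'.differentiableAt.differentiableWithinAt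
  have hmaps : MapsTo g (ball (f x) ε) (closedBall (g (f x)) R) := by
    intro w hw
    obtain ⟨z, hz, rfl⟩ := hball hw
    rw [hgf hz, hgf hx]
    exact hUR hz
  have hbound := Complex.norm_fderiv_le_div_of_mapsTo_ball hgd hmaps hε
  rw [hge.fderiv] at hbound
  have h1 := (e.symm : E →L[ℂ] E).le_of_opNorm_le hbound (fderiv ℂ f x v)
  rw [← he] at h1 ⊢
  simpa using h1

/-- **Hurwitz's theorem** in several variables: a limit of nowhere vanishing holomorphic functions
on a connected open set which is nonzero at one point vanishes nowhere. -/
lemma ne_zero_of_tendsto_of_ne_zero {ι E : Type*} [NormedAddCommGroup E] [NormedSpace ℂ E]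
    {l : Filter ι} [l.NeBot] {D : ι → E → ℂ} {D₀ : E → ℂ} {U : Set E} (hU : IsOpen U)
    (hconn : IsPreconnected U) (hD : ∀ i, DifferentiableOn ℂ (D i) U)
    (hD₀ : DifferentiableOn ℂ D₀ U)
    (hlim : ∀ z ∈ U, Tendsto (fun q : ι × E => D q.1 q.2) (l ×ˢ 𝓝 z) (𝓝 (D₀ z)))
    (hne : ∀ i, ∀ z ∈ U, D i z ≠ 0) {x : E} (hx : x ∈ U) (hx0 : D₀ x ≠ 0) {z : E} (hz : z ∈ U) :
    D₀ z ≠ 0 := by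
  have hopen : IsOpen (U ∩ D₀ ⁻¹' {0}ᶜ) :=
    hD₀.continuousOn.isOpen_inter_preimage hU isOpen_compl_singleton
  refine (hconn.subset_of_closure_inter_subset hopen ⟨x, hx, hx, hx0⟩ ?_ hz).2
  rintro p ⟨hpc, hp⟩
  refine ⟨hp, fun hp0 => ?_⟩
  obtain ⟨R, hR, hRU⟩ := Metric.isOpen_iff.1 hU p hp
  obtain ⟨q, ⟨-, hq0⟩, hqp⟩ := Metric.mem_closure_iff.1 hpc R hR
  replace hp0 : D₀ p = 0 := hp0
  replace hq0 : D₀ q ≠ 0 := hq0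
  set v := q - p with hv
  have hvR : ‖v‖ < R := by rwa [hv, ← dist_eq_norm, dist_comm]
  let c : ℂ → E := fun t => p + t • v
  have hc : Differentiable ℂ c := by fun_prop
  have hVo : IsOpen (c ⁻¹' ball p R) := isOpen_ball.preimage hc.continuous
  have hVconv : Convex ℝ (c ⁻¹' ball p R) := by
    have heq : c ⁻¹' ball p R = {t ∈ univ | ‖v‖ • ‖t‖ < R} := by
      ext t
      simp [c, norm_smul, mul_comm]
    rw [heq]
    exact (convexOn_univ_norm.smul (norm_nonneg v)).convex_lt R
  have h0V : (0 : ℂ) ∈ c ⁻¹' ball p R := by simp [c, hR]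
  have h1V : (1 : ℂ) ∈ c ⁻¹' ball p R := by simpa [c] using hvR
  have han : AnalyticOnNhd ℂ (fun t => D₀ (c t)) (c ⁻¹' ball p R) :=
    DifferentiableOn.analyticOnNhd
      (hD₀.comp hc.differentiableOn fun t ht => hRU ht) hVo
  have hiso : ∀ᶠ t in 𝓝[≠] (0 : ℂ), D₀ (c t) ≠ 0 := by
    refine (han 0 h0V).eventually_eq_zero_or_eventually_ne_zero.resolve_left fun h => hq0 ?_
    have := han.eqOn_zero_of_preconnected_of_eventuallyEq_zero hVconv.isPreconnected h0V h h1V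
    simpa [c, hv] using this
  obtain ⟨ρ, hρ, hρV⟩ := Metric.eventually_nhds_iff_ball.1
    (Filter.Eventually.and (hVo.mem_nhds h0V) (eventually_nhdsWithin_iff.1 hiso))
  have hin : ∀ t ∈ closedBall (0 : ℂ) (ρ / 2), c t ∈ U := fun t ht =>
    hRU (hρV t (closedBall_subset_ball (by linarith) ht)).1
  obtain ⟨δ, hδ, hev⟩ := exists_pos_eventually_le_norm_of_ne_zero (l := l)
    (k := fun i t => D i (c t)) (k₀ := fun t => D₀ (c t)) (half_pos hρ)
    (Eventually.of_forall fun i => (hD i).comp hc.differentiableOn hin)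
    (fun t ht => (hlim _ (hin t (sphere_subset_closedBall ht))).comp
      (tendsto_id.prodMap hc.continuous.continuousAt))
    (fun t ht => (hρV t (closedBall_subset_ball (by linarith) (sphere_subset_closedBall ht))).2
      (ne_of_mem_sphere ht (by positivity)))
  have hlim0 : Tendsto (fun i => ‖D i (c 0)‖) l (𝓝 0) := by
    have := (hlim p hp).comp (tendsto_id.prodMk (tendsto_const_nhds (x := p)))
    simpa [c, hp0] using this.norm
  obtain ⟨i, hi, hi'⟩ := (hev.and (hlim0.eventually_lt_const hδ)).exists
  exact absurd (hi fun t ht => hne i _ (hin t ht)) (not_le.2 hi')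

/-- If holomorphic maps converge locally uniformly and the limit has invertible differential at
`a`, then every neighbourhood of `a` eventually contains a point mapped to the limit value. -/
lemma eventually_mem_image_of_det_fderiv_ne_zero {ι E : Type*} [NormedAddCommGroup E]
    [NormedSpace ℂ E] [FiniteDimensional ℂ E] {l : Filter ι} {f : ι → E → E} {g : E → E}
    {U : Set E} (hU : IsOpen U) (hf : ∀ i, DifferentiableOn ℂ (f i) U)
    (hg : DifferentiableOn ℂ g U) (hlim : TendstoLocallyUniformlyOn f g l U) {a : E} (ha : a ∈ U)
    (hdet : (fderiv ℂ g a).det ≠ 0) {V : Set E} (hV : V ∈ 𝓝 a) : ∀ᶠ i in l, g a ∈ f i '' V := by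
  have : CompleteSpace E := FiniteDimensional.complete ℂ E
  let e := (fderiv ℂ g a).toContinuousLinearEquivOfDetNeZero hdet
  let N : NNReal := ‖(e.symm : E →L[ℂ] E)‖₊ + 1
  let s : (fderiv ℂ g a).NonlinearRightInverse :=
    { toFun := e.symm
      nnnorm := N
      bound' := fun y => ((e.symm : E →L[ℂ] E).le_opNorm y).trans (by
        gcongr
        simp [N])
      right_inv' := fun y => e.apply_symm_apply y }
  have hN : 0 < N := by positivity
  let c : NNReal := N⁻¹ / 2
  have hc : 0 < c := by positivity
  have hder := Metric.tendsto_nhds.1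
    (tendsto_fderiv_of_tendstoLocallyUniformlyOn hU hf hg hlim ha) c hc
  obtain ⟨P, hP, Q, hQ, hPQ⟩ := Filter.eventually_prod_iff.1 hder
  obtain ⟨r, hr, hrV⟩ := nhds_basis_closedBall.mem_iff.1
    (Filter.inter_mem (Filter.inter_mem hV (hU.mem_nhds ha)) hQ)
  have hrad : 0 < (N⁻¹ - c : ℝ) * r := by
    have : (c : ℝ) = (N : ℝ)⁻¹ / 2 := by simp [c]
    rw [this, NNReal.coe_inv]
    have : (0 : ℝ) < (N : ℝ)⁻¹ := by positivity
    nlinarith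
  filter_upwards [hP, Metric.tendsto_nhds.1 (hlim.tendsto_at ha) _ hrad] with i hi hia
  have happ : ApproximatesLinearOn (f i) (fderiv ℂ g a) (closedBall a r) c := by
    intro y hy w hw
    refine Convex.norm_image_sub_le_of_norm_hasFDerivWithin_le' (𝕜 := ℂ)
      (fun u hu => (((hf i).differentiableAt
        (hU.mem_nhds (hrV hu).1.2)).hasFDerivAt).hasFDerivWithinAt)
      (fun u hu => ?_) (convex_closedBall a r) hw hy
    rw [← dist_eq_norm]
    exact (hPQ hi (hrV hu).2).le
  obtain ⟨y, hy, hya⟩ := happ.surjOn_closedBall_of_nonlinearRightInverse s hr.le Subset.rfl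
    (mem_closedBall'.2 hia.le)
  exact ⟨y, (hrV hy).1.1, hya⟩

/-- A locally uniform limit of injective holomorphic maps on a bounded connected open set, whose
images contain a fixed ball around the common value at `x`, is injective. -/
theorem injOn_of_tendstoLocallyUniformlyOn {ι E : Type*} [NormedAddCommGroup E] [NormedSpace ℂ E]
    [FiniteDimensional ℂ E] {l : Filter ι} [l.NeBot] {f : ι → E → E} {g : E → E} {U : Set E}
    (hU : IsOpen U) (hconn : IsPreconnected U) (hbdd : Bornology.IsBounded U)
    (hf : ∀ i, DifferentiableOn ℂ (f i) U) (hinj : ∀ i, InjOn (f i) U)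
    (hg : DifferentiableOn ℂ g U) (hlim : TendstoLocallyUniformlyOn f g l U) {x : E} (hx : x ∈ U)
    {ε : ℝ} (hε : 0 < ε) (hball : ∀ i, ball (f i x) ε ⊆ f i '' U) : InjOn g U := by
  have hder := fun z (hz : z ∈ U) => tendsto_fderiv_of_tendstoLocallyUniformlyOn hU hf hg hlim hz
  obtain ⟨R, hR⟩ := hbdd.subset_closedBall x
  have hdetx : (fderiv ℂ g x).det ≠ 0 := by
    refine fun h => LinearMap.det_eq_zero_iff_ker_ne_bot.1 h (LinearMap.ker_eq_bot'.2 fun v hv => ?_)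
    replace hv : fderiv ℂ g x v = 0 := hv
    have h1 : Tendsto (fun i => fderiv ℂ (f i) x) l (𝓝 (fderiv ℂ g x)) :=
      (hder x hx).comp (tendsto_id.prodMk (tendsto_const_nhds (x := x)))
    have h2 : Tendsto (fun i => R / ε * ‖fderiv ℂ (f i) x v‖) l
        (𝓝 (R / ε * ‖fderiv ℂ g x v‖)) :=
      ((((ContinuousLinearMap.apply ℂ E v).continuous.tendsto _).comp h1).norm).const_mul _
    have h3 := ge_of_tendsto' h2 fun i =>
      norm_le_mul_norm_fderiv_of_injOn hU (hf i) (hinj i) hx hε hR (hball i) v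
    simpa [hv] using h3
  have hdet : ∀ z ∈ U, (fderiv ℂ g z).det ≠ 0 := fun z hz =>
    ne_zero_of_tendsto_of_ne_zero (D := fun i z => (fderiv ℂ (f i) z).det)
      (D₀ := fun z => (fderiv ℂ g z).det) hU hconn
      (fun i => differentiableOn_clm_det (differentiableOn_fderiv_apply (hf i) hU))
      (differentiableOn_clm_det (differentiableOn_fderiv_apply hg hU))
      (fun z hz => (ContinuousLinearMap.continuous_det.tendsto _).comp (hder z hz))
      (fun i z hz h => LinearMap.det_eq_zero_iff_ker_ne_bot.1 h
        (LinearMap.ker_eq_bot.2 (injective_fderiv_of_injOn rfl hU (hf i) (hinj i) hz)))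
      hx hdetx hz
  intro a ha b hb hab
  by_contra hne
  obtain ⟨V, W, hVo, hWo, haV, hbW, hVW⟩ := t2_separation hne
  obtain ⟨i, ⟨y, hy, hya⟩, ⟨w, hw, hwb⟩⟩ := ((eventually_mem_image_of_det_fderiv_ne_zero hU hf hg
    hlim ha (hdet a ha) (Filter.inter_mem (hVo.mem_nhds haV) (hU.mem_nhds ha))).and
    (eventually_mem_image_of_det_fderiv_ne_zero hU hf hg
    hlim hb (hdet b hb) (Filter.inter_mem (hWo.mem_nhds hbW) (hU.mem_nhds hb)))).exists
  have hyw := hinj i hy.2 hw.2 (by rw [hya, hwb, hab])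
  exact disjoint_left.1 hVW hy.1 (hyw ▸ hw.1)

end HolomorphicMaps

/-- Higher-dimensional Hurwitz-type theorem (Deng–Guan–Zhang): a locally
uniform limit of injective holomorphic maps `f_j : Ω → ℂⁿ` with `f_j x = 0`
whose images all contain a fixed ball `B_ε(0)` is injective. -/
theorem stmt_6 (n : ℕ) (Ω : Set (EuclideanSpace ℂ (Fin n)))
    (hopen : IsOpen Ω) (hconn : IsConnected Ω) (hbdd : Bornology.IsBounded Ω)
    (x : EuclideanSpace ℂ (Fin n)) (hx : x ∈ Ω)
    (f : ℕ → EuclideanSpace ℂ (Fin n) → EuclideanSpace ℂ (Fin n))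
    (F : EuclideanSpace ℂ (Fin n) → EuclideanSpace ℂ (Fin n))
    (hhol : ∀ j, DifferentiableOn ℂ (f j) Ω)
    (hinj : ∀ j, Set.InjOn (f j) Ω)
    (hx0 : ∀ j, f j x = 0)
    (hF : DifferentiableOn ℂ F Ω)
    (hconv : TendstoLocallyUniformlyOn f F atTop Ω)
    (ε : ℝ) (hε : 0 < ε)
    (hball : ∀ j, Metric.ball (0 : EuclideanSpace ℂ (Fin n)) ε ⊆ f j '' Ω) :
    Set.InjOn F Ω := by
  refine injOn_of_tendstoLocallyUniformlyOn hopen hconn.isPreconnected hbdd hhol hinj hF hconv hx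
    hε fun j => ?_
  rw [hx0 j]
  exact hball j
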